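/- arXiv:2411.13374 — 12 statements merged into one kernel-verified Lean document; each statement's English description precedes it below -/
import Mathlib

section
/- Let G = (V, E) be a prime finite simple graph and let (y, x, X, α(X)) be a probe in G with P = {x, y} ∪ X ∪ α(X). If no vertex z ∈ X satisfies that z is non-adjacent to every vertex of P ∖ {x, z}, then the subgraph of G induced on P has no non-trivial module, i.e., it is prime. -/
/-- `M` is a module of `G`: every vertex outside `M` is adjacent to all
vertices of `M` or to none of them. -/
def IsModule {V : Type*} (G : SimpleGraph V) (M : Finset V) : Prop :=
  ∀ v ∉ M, (∀ m ∈ M, G.Adj v m) ∨ (∀ m ∈ M, ¬ G.Adj v m)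

/-- `M` is a non-trivial module of `G`. -/
def IsNontrivialModule {V : Type*} [Fintype V] (G : SimpleGraph V) (M : Finset V) : Prop :=
  IsModule G M ∧ 2 ≤ M.card ∧ M ≠ Finset.univ

/-- `G` is prime: it has no non-trivial module. -/
def IsPrime {V : Type*} [Fintype V] (G : SimpleGraph V) : Prop :=
  ∀ M : Finset V, ¬ IsNontrivialModule G M

/-- `M` is a module of the subgraph of `G` induced on `P`. -/
def IsModuleOn {V : Type*} (G : SimpleGraph V) (P M : Finset V) : Prop :=
  M ⊆ P ∧ ∀ v ∈ P, v ∉ M → (∀ m ∈ M, G.Adj v m) ∨ (∀ m ∈ M, ¬ G.Adj v m)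

/-- `(y, x, X, A)` is a probe in `G` (`A` plays the role of `α(X)`). -/
def IsProbe {V : Type*} [Fintype V] [DecidableEq V] (G : SimpleGraph V)
    (y x : V) (X A : Finset V) : Prop :=
  -- (1) the sets `{x}`, `{y}`, `X`, `A` are nonempty, pairwise disjoint,
  -- and `P = {x, y} ∪ X ∪ A` is a proper subset of `V`:
  X.Nonempty ∧ A.Nonempty ∧ y ≠ x ∧
  x ∉ X ∧ x ∉ A ∧ y ∉ X ∧ y ∉ A ∧ Disjoint X A ∧
  insert x (insert y (X ∪ A)) ≠ Finset.univ ∧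
  -- (2) `y ∼ x`, `y ∥ X ∪ A`, `x ∼ X`, `x ∥ A`, and the subgraph induced
  -- on `P` is connected:
  G.Adj y x ∧
  (∀ v ∈ X ∪ A, ¬ G.Adj y v) ∧
  (∀ v ∈ X, G.Adj x v) ∧
  (∀ v ∈ A, ¬ G.Adj x v) ∧
  (G.induce ((insert x (insert y (X ∪ A)) : Finset V) : Set V)).Connected ∧
  -- (3) every vertex outside `P` is one of the three types:
  ∀ t ∉ insert x (insert y (X ∪ A)),
    (∀ v ∈ X ∪ A, ¬ G.Adj t v) ∨
    ((∀ v ∈ X, G.Adj t v) ∧ (∀ v ∈ A, ¬ G.Adj t v)) ∨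
    (∀ v ∈ X ∪ A, G.Adj t v)

/-- A property passed along edges of a connected graph holds everywhere once it holds somewhere. -/
theorem SimpleGraph.Connected.forall_of_adj {W : Type*} {H : SimpleGraph W} (hH : H.Connected)
    {p : W → Prop} (hp : ∀ u v, H.Adj u v → p u → p v) {a : W} (ha : p a) (b : W) : p b := by
  obtain ⟨w⟩ := hH.preconnected a b
  induction w with
  | nil => exact ha
  | cons h _ ih => exact ih (hp _ _ h ha)

/-- In a prime graph, a module that misses a vertex has at most one vertex. -/
theorem IsPrime.eq_of_mem_module {V : Type*} [Fintype V] {G : SimpleGraph V} (hG : IsPrime G)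
    {N : Finset V} (hN : IsModule G N) {x : V} (hx : x ∉ N) {a b : V} (ha : a ∈ N) (hb : b ∈ N) :
    a = b := by
  by_contra hab
  exact hG N ⟨hN, Finset.one_lt_card.2 ⟨a, ha, b, hb, hab⟩,
    fun h => hx (h ▸ Finset.mem_univ x)⟩

theorem probe_prime_of_no_isolated_z
    {V : Type*} [Fintype V] [DecidableEq V] (G : SimpleGraph V)
    (hprime : IsPrime G) (y x : V) (X A : Finset V)
    (hprobe : IsProbe G y x X A)
    (hZ : ¬ ∃ z ∈ X, ∀ w ∈ insert x (insert y (X ∪ A)), w ≠ x → w ≠ z → ¬ G.Adj z w) :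
    ∀ M : Finset V, IsModuleOn G (insert x (insert y (X ∪ A))) M →
      2 ≤ M.card → M = insert x (insert y (X ∪ A)) := by
  intro M hM hcard
  obtain ⟨hMP, hMod⟩ := hM
  obtain ⟨-, -, hyx, hxX, hxA, hyX, hyA, hXA, -, hadj, hyXA, hxadj, hxnadj, hconn, hout⟩ := hprobe
  obtain ⟨a, ha, b, hb, hab⟩ := Finset.one_lt_card.1 hcard
  have hsymm : ∀ u v, G.Adj u v → G.Adj v u := fun _ _ h => h.symm
  simp only [Finset.subset_iff, Finset.mem_insert, Finset.mem_union] at *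
  push Not at hZ
  by_cases hxM : x ∈ M
  · by_cases hyM : y ∈ M
    · have hclosed : ∀ u v, (v = x ∨ v = y ∨ v ∈ X ∨ v ∈ A) → G.Adj u v → u ∈ M → v ∈ M := by
        grind
      have hall := hconn.forall_of_adj (p := fun v => v.1 ∈ M)
        (fun u v huv hu => hclosed u v (by simpa using v.2) huv hu)
        (a := ⟨x, by simp⟩) hxM
      refine Finset.Subset.antisymm (fun v hv => by simpa using hMP hv) (fun v hv => ?_)
      exact hall ⟨v, hv⟩
    · exfalso
      grind
  · exfalso
    by_cases hyM : y ∈ M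
    · have hMX : ∀ v ∈ M, v ≠ y → v ∈ X := by grind
      obtain ⟨v, hvM, hvy⟩ : ∃ v ∈ M, v ≠ y := by grind
      obtain ⟨w, hwP, hwx, hwv, hvw⟩ := hZ v (hMX v hvM hvy)
      have hwM : w ∈ M := by grind
      have hwy : w ≠ y := by grind
      have hmod : IsModule G (M.erase y) := by
        intro t ht
        simp only [Finset.mem_erase] at ht ⊢
        by_cases htP : t = x ∨ t = y ∨ t ∈ X ∨ t ∈ A
        · grind
        · rcases hout t htP with h | ⟨h, -⟩ | h
          · exact Or.inr fun m hm => h m (Or.inl (hMX m hm.2 hm.1))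
          · exact Or.inl fun m hm => h m (hMX m hm.2 hm.1)
          · exact Or.inl fun m hm => h m (Or.inl (hMX m hm.2 hm.1))
      exact hwv (hprime.eq_of_mem_module hmod (x := y) (by simp) (by simp [hwM, hwy])
        (by simp [hvM, hvy]))
    · have hmod : IsModule G M := by
        intro t ht
        by_cases htP : t = x ∨ t = y ∨ t ∈ X ∨ t ∈ A
        · exact hMod t htP ht
        · have hMXA : ∀ m ∈ M, m ∈ X ∨ m ∈ A := by grind
          rcases hout t htP with h | ⟨h₁, h₂⟩ | h
          · exact Or.inr fun m hm => h m (hMXA m hm)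
          · rcases hMod x (by simp) hxM with h | h
            · exact Or.inl fun m hm => h₁ m
                ((hMXA m hm).resolve_right fun hA => hxnadj m hA (h m hm))
            · exact Or.inr fun m hm => h₂ m
                ((hMXA m hm).resolve_left fun hmX => h m hm (hxadj m hmX))
          · exact Or.inl fun m hm => h m (hMXA m hm)
      exact hab (hprime.eq_of_mem_module hmod hxM ha hb)
end

section
/- Let G = (V, E) be a finite simple graph and let (y, x, X, α(X)) be a probe in G with P = {x, y} ∪ X ∪ α(X). If z ∈ X is non-adjacent to every vertex of P ∖ {x, z}, then {y, z} is a non-trivial module of the subgraph of G induced on P. -/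
theorem probe_yz_is_nontrivial_module
    {V : Type*} [Fintype V] [DecidableEq V] (G : SimpleGraph V)
    (y x : V) (X A : Finset V)
    (hprobe : IsProbe G y x X A)
    (z : V) (hz : z ∈ X)
    (hziso : ∀ w ∈ insert x (insert y (X ∪ A)), w ≠ x → w ≠ z → ¬ G.Adj z w) :
    IsModuleOn G (insert x (insert y (X ∪ A))) {y, z} ∧
      2 ≤ ({y, z} : Finset V).card ∧
      ({y, z} : Finset V) ≠ insert x (insert y (X ∪ A)) := by
  obtain ⟨-, -, hyx, hxX, -, hyX, -, -, -, hadj, hy, hxadj, -⟩ := hprobe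
  have hyz : y ≠ z := fun h => hyX (h ▸ hz)
  have hxz : x ≠ z := fun h => hxX (h ▸ hz)
  refine ⟨⟨?_, fun v hv hvM => ?_⟩, (Finset.card_pair hyz).ge, fun h => ?_⟩
  · intro v hv
    grind
  · simp only [Finset.mem_insert, Finset.mem_singleton, not_or] at hvM
    simp only [Finset.mem_insert, Finset.mem_singleton, forall_eq_or_imp, forall_eq]
    by_cases hvx : v = x
    · subst hvx
      exact Or.inl ⟨hadj.symm, hxadj z hz⟩
    · have hvXA : v ∈ X ∪ A := by
        simpa only [Finset.mem_insert, hvx, hvM.1, false_or] using hv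
      exact Or.inr ⟨fun h => hy v hvXA h.symm, fun h => hziso v hv hvx hvM.2 h.symm⟩
  · have hx : x ∈ ({y, z} : Finset V) := h ▸ Finset.mem_insert_self _ _
    simp [hyx.symm, hxz] at hx
end

section
/- Let G = (V, E) be a finite simple graph and let (y, x, X, α(X)) be a probe in G with P = {x, y} ∪ X ∪ α(X). If M is a module of the subgraph of G induced on P such that |M| ≥ 2 and M ∩ {x, y} = ∅, then M ⊆ X or M ⊆ α(X), and M is a non-trivial module of G. -/
theorem probe_module_avoiding_xy
    {V : Type*} [Fintype V] [DecidableEq V] (G : SimpleGraph V)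
    (y x : V) (X A : Finset V)
    (hprobe : IsProbe G y x X A)
    (M : Finset V)
    (hmod : IsModuleOn G (insert x (insert y (X ∪ A))) M)
    (hcard : 2 ≤ M.card)
    (hxy : M ∩ {x, y} = ∅) :
    (M ⊆ X ∨ M ⊆ A) ∧ IsNontrivialModule G M := by
  obtain ⟨-, -, -, -, -, -, -, -, -, -, -, hxX, hxA, -, hout⟩ := hprobe
  obtain ⟨hMP, hM⟩ := hmod
  have hxM : x ∉ M := fun h => by simpa [hxy] using Finset.mem_inter.2 ⟨h, show x ∈ {x, y} by simp⟩
  have hyM : y ∉ M := fun h => by simpa [hxy] using Finset.mem_inter.2 ⟨h, show y ∈ {x, y} by simp⟩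
  have hMXA : ∀ m ∈ M, m ∈ X ∨ m ∈ A := by
    intro m hm
    have h := hMP hm
    simp only [Finset.mem_insert, Finset.mem_union] at h
    rcases h with rfl | rfl | h
    · exact absurd hm hxM
    · exact absurd hm hyM
    · exact h
  have hside : M ⊆ X ∨ M ⊆ A := by
    rcases hM x (by simp) hxM with h | h
    · exact Or.inl fun m hm => (hMXA m hm).resolve_right fun hA => hxA m hA (h m hm)
    · exact Or.inr fun m hm => (hMXA m hm).resolve_left fun hX => h m hm (hxX m hX)
  refine ⟨hside, fun v hv => ?_, hcard, fun h => hxM (h ▸ Finset.mem_univ x)⟩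
  by_cases hvP : v ∈ insert x (insert y (X ∪ A))
  · exact hM v hvP hv
  · rcases hout v hvP with h | ⟨hX, hA⟩ | h
    · exact Or.inr fun m hm => h m (Finset.mem_union.2 (hMXA m hm))
    · rcases hside with hs | hs
      · exact Or.inl fun m hm => hX m (hs hm)
      · exact Or.inr fun m hm => hA m (hs hm)
    · exact Or.inl fun m hm => h m (Finset.mem_union.2 (hMXA m hm))
end

section
/- Let G = (V, E) be a finite simple graph and let (y, x, X, α(X)) be a probe in G with P = {x, y} ∪ X ∪ α(X). If M is a module of the subgraph of G induced on P with {x, y} ⊆ M, then M = P. -/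
/-- In a preconnected graph, a set closed under adjacency that contains one vertex contains all
vertices. -/
theorem SimpleGraph.Preconnected.mem_of_adj_closed {W : Type*} {H : SimpleGraph W}
    (hH : H.Preconnected) {s : Set W} (hs : ∀ a b, H.Adj a b → a ∈ s → b ∈ s)
    {u : W} (hu : u ∈ s) (v : W) : v ∈ s := by
  obtain ⟨p⟩ := hH u v
  induction p with
  | nil => exact hu
  | cons h _ ih => exact ih (hs _ _ h hu)

theorem probe_module_containing_xy
    {V : Type*} [Fintype V] [DecidableEq V] (G : SimpleGraph V)
    (y x : V) (X A : Finset V)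
    (hprobe : IsProbe G y x X A)
    (M : Finset V)
    (hmod : IsModuleOn G (insert x (insert y (X ∪ A))) M)
    (hxy : ({x, y} : Finset V) ⊆ M) :
    M = insert x (insert y (X ∪ A)) := by
  obtain ⟨-, -, -, -, -, -, -, -, -, -, hy, -, -, hconn, -⟩ := hprobe
  obtain ⟨hMP, hM⟩ := hmod
  have hxM : x ∈ M := hxy (by simp)
  have hyM : y ∈ M := hxy (by simp)
  refine Finset.Subset.antisymm hMP fun v hv => ?_
  refine hconn.preconnected.mem_of_adj_closed (s := {a | (a : V) ∈ M}) ?_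
    (u := ⟨x, by simp⟩) hxM ⟨v, hv⟩
  rintro ⟨a, ha⟩ ⟨b, hb⟩ hab (haM : a ∈ M)
  change b ∈ M
  have hadj : G.Adj a b := hab
  by_contra hbM
  have hbP : b ∈ insert x (insert y (X ∪ A)) := hb
  have hbXA : b ∈ X ∪ A := by
    rw [Finset.mem_insert, Finset.mem_insert] at hbP
    rcases hbP with rfl | rfl | h
    · exact absurd hxM hbM
    · exact absurd hyM hbM
    · exact h
  rcases hM b hb hbM with h | h
  · exact hy b hbXA (h y hyM).symm
  · exact h a haM hadj.symm
end

section
/- Let G be a prime finite simple graph with |V| ≥ 3 whose vertex set V is partitioned into nonempty sets C_1, …, C_k and (possibly empty) sets α(C_1), …, α(C_k), where k ≥ 2, such that C_i ∼ C_j for all distinct i, j, and α(C_i) ∥ (C_j ∪ α(C_j)) for all distinct i, j. Then there is at most one index i ∈ [k] with |C_i ∪ α(C_i)| = 1. -/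
theorem at_most_one_singleton_part
    {V : Type*} [Fintype V] [DecidableEq V] (G : SimpleGraph V)
    (hprime : IsPrime G) (hcard : 3 ≤ Fintype.card V)
    (k : ℕ) (hk : 2 ≤ k) (C A : Fin k → Finset V)
    (hCne : ∀ i, (C i).Nonempty)
    (hdisj : ∀ i, Disjoint (C i) (A i))
    (hdisj' : ∀ i j, i ≠ j → Disjoint (C i ∪ A i) (C j ∪ A j))
    (hcover : Finset.univ.biUnion (fun i => C i ∪ A i) = Finset.univ)
    (hCC : ∀ i j, i ≠ j → ∀ u ∈ C i, ∀ v ∈ C j, G.Adj u v)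
    (hAA : ∀ i j, i ≠ j → ∀ u ∈ A i, ∀ v ∈ C j ∪ A j, ¬ G.Adj u v) :
    ∀ i j : Fin k, (C i ∪ A i).card = 1 → (C j ∪ A j).card = 1 → i = j := by
  intro i j hi hj
  by_contra hij
  obtain ⟨a, ha⟩ := Finset.card_eq_one.mp hi
  obtain ⟨b, hb⟩ := Finset.card_eq_one.mp hj
  have haC : a ∈ C i := by
    obtain ⟨c, hc⟩ := hCne i
    have hca : c ∈ C i ∪ A i := Finset.mem_union_left _ hc
    rw [ha, Finset.mem_singleton] at hca
    exact hca ▸ hc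
  have hbC : b ∈ C j := by
    obtain ⟨c, hc⟩ := hCne j
    have hcb : c ∈ C j ∪ A j := Finset.mem_union_left _ hc
    rw [hb, Finset.mem_singleton] at hcb
    exact hcb ▸ hc
  have hab : a ≠ b := G.ne_of_adj (hCC i j hij a haC b hbC)
  refine hprime {a, b} ⟨?_, (Finset.card_pair hab).ge, ?_⟩
  · intro v hv
    simp only [Finset.mem_insert, Finset.mem_singleton, not_or] at hv
    obtain ⟨l, -, hl⟩ := Finset.mem_biUnion.mp (hcover ▸ Finset.mem_univ v)
    have hli : l ≠ i := by
      rintro rfl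
      rw [ha, Finset.mem_singleton] at hl
      exact hv.1 hl
    have hlj : l ≠ j := by
      rintro rfl
      rw [hb, Finset.mem_singleton] at hl
      exact hv.2 hl
    simp only [Finset.mem_insert, Finset.mem_singleton, forall_eq_or_imp, forall_eq]
    rcases Finset.mem_union.mp hl with hl | hl
    · exact Or.inl ⟨hCC l i hli v hl a haC, hCC l j hlj v hl b hbC⟩
    · exact Or.inr ⟨hAA l i hli v hl a (Finset.mem_union_left _ haC),
        hAA l j hlj v hl b (Finset.mem_union_left _ hbC)⟩
  · intro h
    have hle := Finset.card_le_two (a := a) (b := b)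
    rw [h, Finset.card_univ] at hle
    omega
end

section
/- Let G be a prime and connected finite simple graph whose vertex set V is partitioned into nonempty sets C_1, …, C_k and (possibly empty) sets α(C_1), …, α(C_k), where k ≥ 2, such that C_i ∼ C_j for all distinct i, j, and α(C_i) ∥ (C_j ∪ α(C_j)) for all distinct i, j. Then for every index i with |C_i ∪ α(C_i)| ≥ 2 the set α(C_i) is nonempty, and moreover some vertex of C_i is adjacent to some vertex of α(C_i). -/
theorem big_part_has_alpha_and_inner_edge
    {V : Type*} [Fintype V] [DecidableEq V] (G : SimpleGraph V)
    (hprime : IsPrime G) (hconn : G.Connected)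
    (k : ℕ) (hk : 2 ≤ k) (C A : Fin k → Finset V)
    (hCne : ∀ i, (C i).Nonempty)
    (hdisj : ∀ i, Disjoint (C i) (A i))
    (hdisj' : ∀ i j, i ≠ j → Disjoint (C i ∪ A i) (C j ∪ A j))
    (hcover : Finset.univ.biUnion (fun i => C i ∪ A i) = Finset.univ)
    (hCC : ∀ i j, i ≠ j → ∀ u ∈ C i, ∀ v ∈ C j, G.Adj u v)
    (hAA : ∀ i j, i ≠ j → ∀ u ∈ A i, ∀ v ∈ C j ∪ A j, ¬ G.Adj u v) :
    ∀ i : Fin k, 2 ≤ (C i ∪ A i).card →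
      (A i).Nonempty ∧ ∃ u ∈ C i, ∃ v ∈ A i, G.Adj u v := by
  intro i hcard
  obtain ⟨j, hji⟩ : ∃ j : Fin k, j ≠ i := by
    have : Nontrivial (Fin k) := Fin.nontrivial_iff_two_le.mpr hk
    exact exists_ne i
  have hpart (v : V) : ∃ l, v ∈ C l ∨ v ∈ A l := by
    simpa using (Finset.ext_iff.mp hcover v)
  obtain ⟨w, hw⟩ := hCne j
  have hw' : w ∉ C i ∪ A i :=
    Finset.disjoint_left.mp (hdisj' j i hji) (Finset.mem_union_left _ hw)
  have hA : (A i).Nonempty := by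
    by_contra hA
    rw [Finset.not_nonempty_iff_eq_empty] at hA
    rw [hA, Finset.union_empty] at hcard hw'
    refine hprime (C i) ⟨fun v hv => ?_, hcard, fun h => hw' (h ▸ Finset.mem_univ w)⟩
    obtain ⟨l, hl⟩ := hpart v
    have hli : l ≠ i := by
      rintro rfl
      simp_all
    rcases hl with hl | hl
    · exact Or.inl fun m hm => hCC l i hli v hl m hm
    · exact Or.inr fun m hm => hAA l i hli v hl m (Finset.mem_union_left _ hm)
  refine ⟨hA, ?_⟩
  obtain ⟨a, ha⟩ := hA
  obtain ⟨p⟩ := hconn.preconnected a w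
  obtain ⟨d, -, hd, hd'⟩ := p.exists_boundary_dart (A i : Set V) ha
    fun h => hw' (Finset.mem_union_right _ h)
  obtain ⟨l, hl⟩ := hpart d.snd
  obtain rfl : i = l := by
    by_contra hil
    exact hAA i l hil d.fst hd d.snd (Finset.mem_union.mpr hl) d.adj
  exact ⟨d.snd, hl.resolve_right hd', d.fst, hd, d.adj.symm⟩
end

section
/- Let G be a connected finite simple graph whose vertex set V is partitioned into nonempty sets C_1, …, C_k and (possibly empty) sets α(C_1), …, α(C_k), where k ≥ 3, such that C_i ∼ C_j for all distinct i, j, and α(C_i) ∥ (C_j ∪ α(C_j)) for all distinct i, j. Let i ≠ j be indices such that α(C_i) ≠ ∅, and let a_j ∈ C_j and b_j ∈ α(C_j) be adjacent vertices. Then (b_j, a_j, C_i, α(C_i)) is a probe in G. -/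
/-- Reachability of `x` inside `P` along a walk in `G`, when every vertex of `S` is
either adjacent to `x` or has all its neighbours in `S`. -/
theorem induce_reachable_of_walk {V : Type*} {G : SimpleGraph V} {P S : Set V} (hSP : S ⊆ P)
    {x : V} (hxP : x ∈ P) (hS : ∀ v ∈ S, G.Adj v x ∨ ∀ w, G.Adj v w → w ∈ S)
    {u : V} (p : G.Walk u x) (hu : u ∈ S) :
    (G.induce P).Reachable ⟨u, hSP hu⟩ ⟨x, hxP⟩ := by
  induction p with
  | nil => exact .refl _
  | @cons u v _ huv _ ih =>
    rcases hS u hu with hux | hnbr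
    · exact SimpleGraph.Adj.reachable (G := G.induce P) hux
    · have hstep : (G.induce P).Adj ⟨u, hSP hu⟩ ⟨v, hSP (hnbr v huv)⟩ := huv
      exact hstep.reachable.trans (ih hxP hS (hnbr v huv))

theorem probe_from_other_part
    {V : Type*} [Fintype V] [DecidableEq V] (G : SimpleGraph V)
    (hconn : G.Connected)
    (k : ℕ) (hk : 3 ≤ k) (C A : Fin k → Finset V)
    (hCne : ∀ i, (C i).Nonempty)
    (hdisj : ∀ i, Disjoint (C i) (A i))
    (hdisj' : ∀ i j, i ≠ j → Disjoint (C i ∪ A i) (C j ∪ A j))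
    (hcover : Finset.univ.biUnion (fun i => C i ∪ A i) = Finset.univ)
    (hCC : ∀ i j, i ≠ j → ∀ u ∈ C i, ∀ v ∈ C j, G.Adj u v)
    (hAA : ∀ i j, i ≠ j → ∀ u ∈ A i, ∀ v ∈ C j ∪ A j, ¬ G.Adj u v)
    (i j : Fin k) (hij : i ≠ j) (hAi : (A i).Nonempty)
    (aj bj : V) (haj : aj ∈ C j) (hbj : bj ∈ A j) (hadj : G.Adj aj bj) :
    IsProbe G bj aj (C i) (A i) := by
  have part_unique : ∀ {v l m}, v ∈ C l ∪ A l → v ∈ C m ∪ A m → l = m := by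
    intro v l m hl hm
    by_contra hne
    exact Finset.disjoint_left.1 (hdisj' l m hne) hl hm
  have exists_part : ∀ v, ∃ l, v ∈ C l ∪ A l := fun v => by
    have hv := Finset.mem_univ v
    rw [← hcover] at hv
    simpa using hv
  have haj' : aj ∈ C j ∪ A j := Finset.mem_union_left _ haj
  have hbj' : bj ∈ C j ∪ A j := Finset.mem_union_right _ hbj
  have haji : aj ∉ C i ∪ A i := fun h => hij (part_unique h haj')
  have hbji : bj ∉ C i ∪ A i := fun h => hij (part_unique h hbj')
  refine ⟨hCne i, hAi, hadj.ne', fun h => haji (Finset.mem_union_left _ h),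
    fun h => haji (Finset.mem_union_right _ h), fun h => hbji (Finset.mem_union_left _ h),
    fun h => hbji (Finset.mem_union_right _ h), hdisj i, ?_, hadj.symm,
    hAA j i hij.symm bj hbj, hCC j i hij.symm aj haj,
    fun v hv h => hAA i j hij v hv aj haj' h.symm, ?_, ?_⟩
  · obtain ⟨l, hl⟩ : ∃ l, l ∉ ({i, j} : Finset (Fin k)) := by
      by_contra! h
      have hcard : k ≤ ({i, j} : Finset (Fin k)).card := by
        simpa using Finset.card_le_card (fun l (_ : l ∈ Finset.univ) => h l)
      have := Finset.card_le_two (a := i) (b := j)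
      omega
    simp only [Finset.mem_insert, Finset.mem_singleton, not_or] at hl
    obtain ⟨c, hc⟩ := hCne l
    have hc' : c ∈ C l ∪ A l := Finset.mem_union_left _ hc
    intro huniv
    have hcP := huniv ▸ Finset.mem_univ c
    rcases Finset.mem_insert.1 hcP with rfl | hcP
    · exact hl.2 (part_unique hc' haj')
    rcases Finset.mem_insert.1 hcP with rfl | hcP
    · exact hl.2 (part_unique hc' hbj')
    · exact hl.1 (part_unique hc' hcP)
  · rw [SimpleGraph.connected_iff_exists_forall_reachable]
    refine ⟨⟨aj, by simp⟩, ?_⟩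
    rintro ⟨v, hv⟩
    rcases Finset.mem_insert.1 hv with rfl | hvP
    · exact .refl _
    rcases Finset.mem_insert.1 hvP with rfl | hvP
    · exact SimpleGraph.Adj.reachable
        (G := G.induce ((insert aj (insert v (C i ∪ A i)) : Finset V) : Set V)) hadj
    · obtain ⟨p⟩ := hconn.preconnected v aj
      have hSP : ((C i ∪ A i : Finset V) : Set V) ⊆
          ((insert aj (insert bj (C i ∪ A i)) : Finset V) : Set V) :=
        fun w hw => Finset.mem_insert_of_mem (Finset.mem_insert_of_mem hw)
      refine (induce_reachable_of_walk hSP (Finset.mem_insert_self _ _) ?_ p hvP).symm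
      intro w hw
      rcases Finset.mem_union.1 hw with hw | hw
      · exact .inl (hCC i j hij w hw aj haj)
      · refine .inr fun z hz => ?_
        obtain ⟨l, hl⟩ := exists_part z
        by_cases hil : i = l
        · exact hil ▸ hl
        · exact absurd hz (hAA i l hil w hw z hl)
  · intro t ht
    simp only [Finset.mem_insert, not_or] at ht
    obtain ⟨l, hl⟩ := exists_part t
    have hli : l ≠ i := by
      rintro rfl
      exact ht.2.2 hl
    rcases Finset.mem_union.1 hl with htC | htA
    · exact .inr (.inl ⟨hCC l i hli t htC,
        fun v hv h => hAA i l hli.symm v hv t hl h.symm⟩)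
    · exact .inl (hAA l i hli t htA)
end

section
/- Let G be a connected finite simple graph, let a be a vertex of G, and let D_1, …, D_k with k ≥ 2 be the vertex sets of the connected components of G − a. For each i let C_i = { v ∈ D_i : v adjacent to a } and α(C_i) = D_i ∖ C_i. Let i ≠ j be indices such that α(C_i) ≠ ∅, let a_j ∈ C_j, and suppose {a, a_j} ∪ D_i ≠ V. Then (a_j, a, C_i, α(C_i)) is a probe in G. -/
/-- Adding a vertex adjacent to some vertex of `s` keeps the induced subgraph connected. -/
lemma SimpleGraph.Connected.induce_insert {V : Type*} {G : SimpleGraph V} {s : Set V}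
    (hs : (G.induce s).Connected) {u v : V} (hv : v ∈ s) (huv : G.Adj u v) :
    (G.induce (insert u s)).Connected := by
  have h := SimpleGraph.induce_union_connected
    (SimpleGraph.induce_pair_connected_of_adj huv).preconnected hs.preconnected
    ⟨v, by simp, hv⟩
  rwa [show ({u, v} : Set V) ∪ s = insert u s by
    rw [Set.insert_union, Set.singleton_union, Set.insert_eq_of_mem hv]] at h

/-- In a connected graph, a nonempty proper set of vertices has an edge leaving it. -/
lemma SimpleGraph.Connected.exists_adj_mem_notMem {V : Type*} {G : SimpleGraph V}
    (hG : G.Connected) {s : Set V} {u v : V} (hu : u ∈ s) (hv : v ∉ s) :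
    ∃ x ∈ s, ∃ y ∉ s, G.Adj x y := by
  obtain ⟨p⟩ := hG.preconnected u v
  obtain ⟨d, -, h₁, h₂⟩ := p.exists_boundary_dart s hu hv
  exact ⟨d.fst, h₁, d.snd, h₂, d.adj⟩

theorem probe_from_articulation_point
    {V : Type*} [Fintype V] [DecidableEq V] (G : SimpleGraph V) [DecidableRel G.Adj]
    (hconn : G.Connected) (a : V)
    (k : ℕ) (hk : 2 ≤ k) (D : Fin k → Finset V)
    -- `D 0, …, D (k-1)` are the vertex sets of the connected components of `G - a`:
    (hDdisj : ∀ i j, i ≠ j → Disjoint (D i) (D j))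
    (hDcover : Finset.univ.biUnion D = Finset.univ.erase a)
    (hDconn : ∀ i, (G.induce ((D i : Finset V) : Set V)).Connected)
    (hDsep : ∀ i j, i ≠ j → ∀ u ∈ D i, ∀ v ∈ D j, ¬ G.Adj u v)
    (i j : Fin k) (hij : i ≠ j)
    (hAi : ((D i).filter (fun v => ¬ G.Adj a v)).Nonempty)
    (aj : V) (haj : aj ∈ (D j).filter (fun v => G.Adj a v))
    (hproper : insert a (insert aj (D i)) ≠ Finset.univ) :
    IsProbe G aj a ((D i).filter (fun v => G.Adj a v))
      ((D i).filter (fun v => ¬ G.Adj a v)) := by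
  have ha : ∀ l, a ∉ D l := fun l hl => by
    have : a ∈ Finset.univ.biUnion D := Finset.mem_biUnion.2 ⟨l, Finset.mem_univ l, hl⟩
    simp [hDcover] at this
  have hcover : ∀ v, v ≠ a → ∃ l, v ∈ D l := fun v hv => by
    have : v ∈ Finset.univ.biUnion D := by simp [hDcover, hv]
    simpa using this
  have hleave : ∀ t, t ≠ a → t ∉ D i → ∀ v ∈ D i, ¬ G.Adj t v := fun t hta hti v hv => by
    obtain ⟨l, hl⟩ := hcover t hta
    exact hDsep l i (fun h => hti (h ▸ hl)) t hl v hv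
  obtain ⟨hajD, hadj⟩ := Finset.mem_filter.1 haj
  have haji : aj ∉ D i := fun h => Finset.disjoint_left.1 (hDdisj i j hij) h hajD
  obtain ⟨w, hw⟩ := hAi
  obtain ⟨c, hc, y, hy, hcy⟩ := hconn.exists_adj_mem_notMem (s := (D i : Set V))
    (Finset.mem_coe.2 (Finset.mem_filter.1 hw).1) (fun h => ha i (Finset.mem_coe.1 h))
  have hac : G.Adj a c := by
    by_cases hya : y = a
    · exact hya ▸ hcy.symm
    · exact (hleave y hya hy c hc hcy.symm).elim
  have hconnP : (G.induce ((insert a (insert aj (D i)) : Finset V) : Set V)).Connected := by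
    rw [Finset.insert_comm, Finset.coe_insert, Finset.coe_insert]
    exact ((hDconn i).induce_insert hc hac).induce_insert (Set.mem_insert _ _) hadj.symm
  unfold IsProbe
  rw [Finset.filter_union_filter_not_eq]
  refine ⟨⟨c, Finset.mem_filter.2 ⟨hc, hac⟩⟩, ⟨w, hw⟩, hadj.ne', ?_, ?_, ?_, ?_,
    Finset.disjoint_filter_filter_not _ _ _, hproper, hadj.symm, hleave aj hadj.ne' haji,
    fun v hv => (Finset.mem_filter.1 hv).2, fun v hv => (Finset.mem_filter.1 hv).2, hconnP,
    fun t ht => Or.inl ?_⟩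
  · exact fun h => ha i (Finset.mem_filter.1 h).1
  · exact fun h => ha i (Finset.mem_filter.1 h).1
  · exact fun h => haji (Finset.mem_filter.1 h).1
  · exact fun h => haji (Finset.mem_filter.1 h).1
  · simp only [Finset.mem_insert, not_or] at ht
    exact hleave t ht.1 ht.2.2
end

section
/- Let G = (V, E) be a connected prime finite simple graph whose vertex set is partitioned into {a}, {a₂}, C₁, α(C₁) with C₁ and α(C₁) nonempty, where a is adjacent to a₂ and to every vertex of C₁ and to no vertex of α(C₁), and a₂ is adjacent to no vertex of C₁ ∪ α(C₁). Let H be the subgraph of G induced on {a} ∪ C₁ ∪ α(C₁). Then every non-trivial module M of H contains a. -/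
theorem nontrivial_module_of_H_contains_a
    {V : Type*} [Fintype V] [DecidableEq V] (G : SimpleGraph V)
    (hconn : G.Connected) (hprime : IsPrime G)
    (a a₂ : V) (C₁ A₁ : Finset V)
    (hC₁ : C₁.Nonempty) (hA₁ : A₁.Nonempty)
    -- `{a}`, `{a₂}`, `C₁`, `α(C₁)` partition the vertex set:
    (hne : a ≠ a₂) (haC : a ∉ C₁) (haA : a ∉ A₁) (ha₂C : a₂ ∉ C₁) (ha₂A : a₂ ∉ A₁)
    (hCA : Disjoint C₁ A₁)
    (hcover : insert a (insert a₂ (C₁ ∪ A₁)) = Finset.univ)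
    -- adjacency conditions on `a` and `a₂`:
    (haa₂ : G.Adj a a₂)
    (haC₁ : ∀ v ∈ C₁, G.Adj a v)
    (haA₁ : ∀ v ∈ A₁, ¬ G.Adj a v)
    (ha₂par : ∀ v ∈ C₁ ∪ A₁, ¬ G.Adj a₂ v)
    (M : Finset V)
    (hmod : IsModuleOn G (insert a (C₁ ∪ A₁)) M)
    (hcard : 2 ≤ M.card) (hMne : M ≠ insert a (C₁ ∪ A₁)) :
    a ∈ M := by
  by_contra ha
  obtain ⟨hsub, hmod⟩ := hmod
  refine hprime M ⟨fun v hv => ?_, hcard, fun h => ha (h ▸ Finset.mem_univ a)⟩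
  by_cases hva₂ : v = a₂
  · subst hva₂
    refine Or.inr fun m hm => ha₂par m ?_
    exact (Finset.mem_insert.1 (hsub hm)).resolve_left (ne_of_mem_of_not_mem hm ha)
  · refine hmod v ?_ hv
    have hvU : v ∈ insert a (insert a₂ (C₁ ∪ A₁)) := hcover ▸ Finset.mem_univ v
    simpa [hva₂] using hvU
end

section
/- Let G = (V, E) be a connected prime finite simple graph whose vertex set is partitioned into {a}, {a₂}, C₁, α(C₁) with C₁ and α(C₁) nonempty, where a is adjacent to a₂ and to every vertex of C₁ and to no vertex of α(C₁), and a₂ is adjacent to no vertex of C₁ ∪ α(C₁). Let H be the subgraph of G induced on {a} ∪ C₁ ∪ α(C₁). If M is a non-trivial module of H with a ∈ M, then C₁ ∖ M ≠ ∅. -/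
theorem nontrivial_module_of_H_misses_part_of_C₁
    {V : Type*} [Fintype V] [DecidableEq V] (G : SimpleGraph V)
    (hconn : G.Connected) (hprime : IsPrime G)
    (a a₂ : V) (C₁ A₁ : Finset V)
    (hC₁ : C₁.Nonempty) (hA₁ : A₁.Nonempty)
    -- `{a}`, `{a₂}`, `C₁`, `α(C₁)` partition the vertex set:
    (hne : a ≠ a₂) (haC : a ∉ C₁) (haA : a ∉ A₁) (ha₂C : a₂ ∉ C₁) (ha₂A : a₂ ∉ A₁)
    (hCA : Disjoint C₁ A₁)
    (hcover : insert a (insert a₂ (C₁ ∪ A₁)) = Finset.univ)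
    -- adjacency conditions on `a` and `a₂`:
    (haa₂ : G.Adj a a₂)
    (haC₁ : ∀ v ∈ C₁, G.Adj a v)
    (haA₁ : ∀ v ∈ A₁, ¬ G.Adj a v)
    (ha₂par : ∀ v ∈ C₁ ∪ A₁, ¬ G.Adj a₂ v)
    (M : Finset V)
    (hmod : IsModuleOn G (insert a (C₁ ∪ A₁)) M)
    (hcard : 2 ≤ M.card) (hMne : M ≠ insert a (C₁ ∪ A₁))
    (haM : a ∈ M) :
    (C₁ \ M).Nonempty := by
  by_contra hempty
  have hCM : C₁ ⊆ M := by
    rwa [Finset.not_nonempty_iff_eq_empty, Finset.sdiff_eq_empty_iff_subset] at hempty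
  obtain ⟨hMP, hM⟩ := hmod
  have hV : ∀ v, v = a ∨ v = a₂ ∨ v ∈ C₁ ∨ v ∈ A₁ := fun v => by
    simpa [← hcover] using Finset.mem_univ v
  refine hprime (insert a₂ M) ⟨fun v hv => Or.inr ?_,
    hcard.trans (Finset.card_le_card (Finset.subset_insert _ _)), fun huniv => hMne ?_⟩
  · rw [Finset.mem_insert, not_or] at hv
    have hvA : v ∈ A₁ := by
      rcases hV v with rfl | h | h | h
      · exact absurd haM hv.2
      · exact absurd h hv.1
      · exact absurd (hCM h) hv.2
      · exact h
    intro m hm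
    rcases Finset.mem_insert.1 hm with rfl | hm
    · exact fun h => ha₂par v (Finset.mem_union_right _ hvA) h.symm
    · rcases hM v (by simp [hvA]) hv.2 with h | h
      · exact absurd (h a haM).symm (haA₁ v hvA)
      · exact h m hm
  · refine hMP.antisymm fun v hv => ?_
    have hva₂ : v ≠ a₂ := by
      rintro rfl
      simp [hne.symm, ha₂C, ha₂A] at hv
    exact (Finset.mem_insert.1 (huniv ▸ Finset.mem_univ v)).resolve_left hva₂
end

section
/- Let G = (V, E) be a connected prime finite simple graph whose vertex set is partitioned into {a}, {a₂}, C₁, α(C₁) with C₁ and α(C₁) nonempty, where a is adjacent to a₂ and to every vertex of C₁ and to no vertex of α(C₁), and a₂ is adjacent to no vertex of C₁ ∪ α(C₁). Let H be the subgraph of G induced on {a} ∪ C₁ ∪ α(C₁), and let M be a non-trivial module of H with a ∈ M, M₁ = M ∩ C₁ ≠ ∅, and M₂ = C₁ ∖ M ≠ ∅. Then: (i) every connected component D of the subgraph of G induced on α(C₁) satisfies D ⊆ M or D ∩ M = ∅; (ii) if some vertex of such a component D is adjacent to some vertex of M₁, then D ⊆ M; (iii) letting α(M₁) be the union of those components of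 the subgraph induced on α(C₁) that contain a vertex adjacent to a vertex of M₁, every vertex of M₂ is adjacent to every vertex of M₁ ∪ α(M₁). -/
/-- `D` is (the vertex set of) a connected component of the subgraph of `G`
induced on `S`: it is a connected subset of `S` with no edge of `G` leaving it
inside `S`. -/
def IsCompOf {V : Type*} (G : SimpleGraph V) (S D : Finset V) : Prop :=
  D ⊆ S ∧ (G.induce ((D : Finset V) : Set V)).Connected ∧
    ∀ u ∈ D, ∀ v ∈ S, v ∉ D → ¬ G.Adj u v

/-- A vertex set that is closed under adjacency inside a connected set `D` and meets `D`
contains `D`. -/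
theorem subset_of_connected_of_adj_closed {V : Type*} {G : SimpleGraph V} {D M : Finset V}
    (hD : (G.induce (D : Set V)).Connected)
    (hclosed : ∀ u ∈ D, ∀ v ∈ D, G.Adj u v → u ∈ M → v ∈ M)
    {d : V} (hdD : d ∈ D) (hdM : d ∈ M) : D ⊆ M := by
  intro e heD
  obtain ⟨p⟩ := hD.preconnected ⟨d, hdD⟩ ⟨e, heD⟩
  have walk_mem : ∀ {x y : (D : Set V)}, (G.induce (D : Set V)).Walk x y →
      (x : V) ∈ M → (y : V) ∈ M := by
    intro x y p
    induction p with
    | nil => exact id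
    | @cons u v w h _ ih => exact fun hu => ih (hclosed u u.2 v v.2 h hu)
  exact walk_mem p hdM

theorem module_of_H_structure
    {V : Type*} [Fintype V] [DecidableEq V] (G : SimpleGraph V)
    (hconn : G.Connected) (hprime : IsPrime G)
    (a a₂ : V) (C₁ A₁ : Finset V)
    (hC₁ : C₁.Nonempty) (hA₁ : A₁.Nonempty)
    -- `{a}`, `{a₂}`, `C₁`, `α(C₁)` partition the vertex set:
    (hne : a ≠ a₂) (haC : a ∉ C₁) (haA : a ∉ A₁) (ha₂C : a₂ ∉ C₁) (ha₂A : a₂ ∉ A₁)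
    (hCA : Disjoint C₁ A₁)
    (hcover : insert a (insert a₂ (C₁ ∪ A₁)) = Finset.univ)
    -- adjacency conditions on `a` and `a₂`:
    (haa₂ : G.Adj a a₂)
    (haC₁ : ∀ v ∈ C₁, G.Adj a v)
    (haA₁ : ∀ v ∈ A₁, ¬ G.Adj a v)
    (ha₂par : ∀ v ∈ C₁ ∪ A₁, ¬ G.Adj a₂ v)
    (M : Finset V)
    (hmod : IsModuleOn G (insert a (C₁ ∪ A₁)) M)
    (hcard : 2 ≤ M.card) (hMne : M ≠ insert a (C₁ ∪ A₁))
    (haM : a ∈ M)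
    (hM₁ : (M ∩ C₁).Nonempty) (hM₂ : (C₁ \ M).Nonempty) :
    -- (i) every component of the subgraph induced on `α(C₁)` is inside or outside `M`:
    (∀ D : Finset V, IsCompOf G A₁ D → D ⊆ M ∨ D ∩ M = ∅) ∧
    -- (ii) components with a vertex adjacent to `M₁ = M ∩ C₁` are inside `M`:
    (∀ D : Finset V, IsCompOf G A₁ D →
      (∃ d ∈ D, ∃ m ∈ M ∩ C₁, G.Adj d m) → D ⊆ M) ∧
    -- (iii) `M₂ = C₁ \ M` is completely adjacent to `M₁ ∪ α(M₁)`: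
    (∀ u ∈ C₁ \ M,
      (∀ v ∈ M ∩ C₁, G.Adj u v) ∧
      (∀ v ∈ A₁, (∃ D : Finset V, IsCompOf G A₁ D ∧ v ∈ D ∧
        ∃ d ∈ D, ∃ m ∈ M ∩ C₁, G.Adj d m) → G.Adj u v)) := by
  have not_adj_M : ∀ v ∈ A₁, v ∉ M → ∀ m ∈ M, ¬ G.Adj v m := by
    intro v hv hvM
    refine (hmod.2 v (by simp [hv]) hvM).resolve_left fun h => ?_
    exact haA₁ v hv (h a haM).symm
  have adj_M : ∀ u ∈ C₁ \ M, ∀ m ∈ M, G.Adj u m := by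
    intro u hu
    obtain ⟨huC, huM⟩ := Finset.mem_sdiff.1 hu
    refine (hmod.2 u (by simp [huC]) huM).resolve_right fun h => ?_
    exact h a haM (haC₁ u huC).symm
  have comp_subset : ∀ D : Finset V, IsCompOf G A₁ D → ∀ d ∈ D, d ∈ M → D ⊆ M := by
    intro D hD d hdD hdM
    refine subset_of_connected_of_adj_closed hD.2.1 (fun u _ v hv huv hu => ?_) hdD hdM
    by_contra hvM
    exact not_adj_M v (hD.1 hv) hvM u hu huv.symm
  have comp_subset_of_adj : ∀ D : Finset V, IsCompOf G A₁ D →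
      (∃ d ∈ D, ∃ m ∈ M ∩ C₁, G.Adj d m) → D ⊆ M := by
    rintro D hD ⟨d, hd, m, hm, hdm⟩
    refine comp_subset D hD d hd ?_
    by_contra hdM
    exact not_adj_M d (hD.1 hd) hdM m (Finset.mem_inter.1 hm).1 hdm
  refine ⟨fun D hD => ?_, comp_subset_of_adj, fun u hu => ⟨fun v hv => ?_, ?_⟩⟩
  · rcases (D ∩ M).eq_empty_or_nonempty with h | ⟨d, hd⟩
    · exact Or.inr h
    · obtain ⟨hdD, hdM⟩ := Finset.mem_inter.1 hd
      exact Or.inl (comp_subset D hD d hdD hdM)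
  · exact adj_M u hu v (Finset.mem_inter.1 hv).1
  · rintro v _ ⟨D, hD, hvD, hadj⟩
    exact adj_M u hu v (comp_subset_of_adj D hD hadj hvD)
end

section
/- Let G = (V, E) be a connected prime finite simple graph whose vertex set is partitioned into {a}, {a₂}, C₁, α(C₁) with C₁ and α(C₁) nonempty, where a is adjacent to a₂ and to every vertex of C₁ and to no vertex of α(C₁), and a₂ is adjacent to no vertex of C₁ ∪ α(C₁). Let H be the subgraph of G induced on {a} ∪ C₁ ∪ α(C₁), and let M be a non-trivial module of H with a ∈ M, M₁ = M ∩ C₁ ≠ ∅, and M₂ = C₁ ∖ M ≠ ∅. Let α(M₁) be the union of those connected components of the subgraph of G induced on α(C₁) that contain a vertex adjacent to a vertex of M₁, and let α(M₂) = α(C₁) ∖ α(M₁). Then for each i ∈ {1, 2}: if α(M_i) ≠ ∅, then (a₂, a, M_i, α(M_i)) is a probe in G; and if α(M_i) = ∅, then |M_i| = 1. -/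
-- The union of those connected components of the subgraph of `G` induced on
-- `A₁` that contain a vertex adjacent to a vertex of `M₁`.
open Classical in
noncomputable def alphaPart {V : Type*} [DecidableEq V] (G : SimpleGraph V)
    (A₁ M₁ : Finset V) : Finset V :=
  A₁.filter (fun v => ∃ D : Finset V, IsCompOf G A₁ D ∧ v ∈ D ∧
    ∃ d ∈ D, ∃ m ∈ M₁, G.Adj d m)

/-- In a connected graph, a set closed under adjacency containing a vertex contains everything. -/
theorem SimpleGraph.Connected.mem_of_adj_closed {V : Type*} {G : SimpleGraph V}
    (hG : G.Connected) {T : Set V} {x : V} (hx : x ∈ T)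
    (hT : ∀ u ∈ T, ∀ v, G.Adj u v → v ∈ T) (v : V) : v ∈ T := by
  obtain ⟨p⟩ := hG.preconnected x v
  induction p with
  | nil => exact hx
  | cons h _ ih => exact ih (hT _ hx _ h)

/-- An induced subgraph is connected if every adjacency-closed set containing a given vertex
contains all its vertices. -/
theorem SimpleGraph.induce_connected_of_adj_closed {V : Type*} {G : SimpleGraph V}
    {S : Set V} {x : V} (hx : x ∈ S)
    (h : ∀ T : Set V, x ∈ T → (∀ u ∈ T, ∀ v ∈ S, G.Adj u v → v ∈ T) → S ⊆ T) :
    (G.induce S).Connected := by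
  rw [SimpleGraph.connected_iff_exists_forall_reachable]
  refine ⟨⟨x, hx⟩, fun ⟨v, hv⟩ => ?_⟩
  exact (h {v | ∃ hv : v ∈ S, (G.induce S).Reachable ⟨x, hx⟩ ⟨v, hv⟩} ⟨hx, .rfl⟩
    (fun u ⟨hu, hr⟩ v hv huv =>
      ⟨hv, hr.trans (SimpleGraph.Adj.reachable (by simpa using huv))⟩) hv).2

theorem exists_isCompOf {V : Type*} {G : SimpleGraph V} {S : Finset V} {v : V} (hv : v ∈ S) :
    ∃ D, IsCompOf G S D ∧ v ∈ D := by
  classical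
  let F : Finset (Finset V) := S.powerset.filter fun D =>
    v ∈ D ∧ (G.induce ((D : Finset V) : Set V)).Connected
  have hF : ({v} : Finset V) ∈ F := by
    simp only [F, Finset.mem_filter, Finset.mem_powerset, Finset.singleton_subset_iff]
    refine ⟨hv, by simp, ?_⟩
    rw [Finset.coe_singleton]
    exact SimpleGraph.Connected.mk (SimpleGraph.Preconnected.of_subsingleton)
  obtain ⟨D, hD, hmax⟩ := F.exists_max_image Finset.card ⟨_, hF⟩
  simp only [F, Finset.mem_filter, Finset.mem_powerset] at hD hmax
  obtain ⟨hDS, hvD, hDc⟩ := hD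
  refine ⟨D, ⟨hDS, hDc, fun u hu w hw hwD huw => ?_⟩, hvD⟩
  have hc : (G.induce ((insert w D : Finset V) : Set V)).Connected := by
    refine SimpleGraph.induce_connected_of_adj_closed (x := u) (by simp [hu]) ?_
    intro T huT hT
    have hDT : ∀ z ∈ D, z ∈ T := fun z hz =>
      hDc.mem_of_adj_closed (T := {z | z.1 ∈ T}) (x := ⟨u, hu⟩) huT
        (fun p hp q hpq => hT p hp q (by simp) (by simpa using hpq)) ⟨z, hz⟩
    intro z hz
    rcases Finset.mem_insert.1 (Finset.mem_coe.1 hz) with rfl | hz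
    · exact hT u huT _ (by simp) huw
    · exact hDT z hz
  have := hmax (insert w D)
    ⟨Finset.insert_subset hw hDS, Finset.mem_insert_of_mem hvD, hc⟩
  rw [Finset.card_insert_of_notMem hwD] at this
  omega

section alphaPart

variable {V : Type*} [DecidableEq V] {G : SimpleGraph V} {A X : Finset V}

theorem mem_alphaPart {v : V} : v ∈ alphaPart G A X ↔
    v ∈ A ∧ ∃ D, IsCompOf G A D ∧ v ∈ D ∧ ∃ d ∈ D, ∃ m ∈ X, G.Adj d m := by
  simp [alphaPart]

theorem alphaPart_subset : alphaPart G A X ⊆ A := fun _ h => (mem_alphaPart.1 h).1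

theorem mem_alphaPart_of_adj {v m : V} (hv : v ∈ A) (hm : m ∈ X) (h : G.Adj v m) :
    v ∈ alphaPart G A X := by
  obtain ⟨D, hD, hvD⟩ := exists_isCompOf (G := G) hv
  exact mem_alphaPart.2 ⟨hv, D, hD, hvD, v, hvD, m, hm, h⟩

theorem alphaPart_adj_closed {u v : V} (hu : u ∈ alphaPart G A X) (hv : v ∈ A)
    (h : G.Adj u v) : v ∈ alphaPart G A X := by
  obtain ⟨_, D, hD, huD, hd⟩ := mem_alphaPart.1 hu
  exact mem_alphaPart.2 ⟨hv, D, hD, by_contra fun hvD => hD.2.2 u huD v hv hvD h, hd⟩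

/-- `alphaPart G A X` is the least subset of `A` that contains the neighbours of `X` in `A` and is
closed under adjacency in `A`. -/
theorem mem_of_mem_alphaPart {T : Set V} (hX : ∀ v ∈ alphaPart G A X, ∀ m ∈ X, G.Adj v m → v ∈ T)
    (hT : ∀ u ∈ T, ∀ v ∈ alphaPart G A X, G.Adj u v → v ∈ T) {v : V}
    (hv : v ∈ alphaPart G A X) : v ∈ T := by
  obtain ⟨_, D, hD, hvD, d, hd, m, hm, hdm⟩ := mem_alphaPart.1 hv
  have hDR : ∀ z ∈ D, z ∈ alphaPart G A X := fun z hz =>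
    mem_alphaPart.2 ⟨hD.1 hz, D, hD, hz, d, hd, m, hm, hdm⟩
  exact hD.2.1.mem_of_adj_closed (T := {z | z.1 ∈ T}) (x := ⟨d, hd⟩) (hX d (hDR d hd) m hm hdm)
    (fun p hp q hpq => hT p hp q (hDR q q.2) (by simpa using hpq)) ⟨v, hvD⟩

end alphaPart

/-- In a prime graph, a nonempty module that misses a vertex is a singleton. -/
theorem IsPrime.card_eq_one {V : Type*} [Fintype V] {G : SimpleGraph V} (hG : IsPrime G)
    {X : Finset V} (hX : X.Nonempty) (hmod : IsModule G X) {x : V} (hx : x ∉ X) :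
    X.card = 1 := by
  have h1 := hX.card_pos
  by_contra h
  exact hG X ⟨hmod, by omega, fun hu => hx (hu ▸ Finset.mem_univ x)⟩

theorem module_of_H_gives_probes
    {V : Type*} [Fintype V] [DecidableEq V] (G : SimpleGraph V)
    (hconn : G.Connected) (hprime : IsPrime G)
    (a a₂ : V) (C₁ A₁ : Finset V)
    (hC₁ : C₁.Nonempty) (hA₁ : A₁.Nonempty)
    -- `{a}`, `{a₂}`, `C₁`, `α(C₁)` partition the vertex set:
    (hne : a ≠ a₂) (haC : a ∉ C₁) (haA : a ∉ A₁) (ha₂C : a₂ ∉ C₁) (ha₂A : a₂ ∉ A₁)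
    (hCA : Disjoint C₁ A₁)
    (hcover : insert a (insert a₂ (C₁ ∪ A₁)) = Finset.univ)
    -- adjacency conditions on `a` and `a₂`:
    (haa₂ : G.Adj a a₂)
    (haC₁ : ∀ v ∈ C₁, G.Adj a v)
    (haA₁ : ∀ v ∈ A₁, ¬ G.Adj a v)
    (ha₂par : ∀ v ∈ C₁ ∪ A₁, ¬ G.Adj a₂ v)
    (M : Finset V)
    (hmod : IsModuleOn G (insert a (C₁ ∪ A₁)) M)
    (hcard : 2 ≤ M.card) (hMne : M ≠ insert a (C₁ ∪ A₁))
    (haM : a ∈ M)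
    (hM₁ : (M ∩ C₁).Nonempty) (hM₂ : (C₁ \ M).Nonempty) :
    -- for `i = 1`, with `M₁ = M ∩ C₁` and `α(M₁) = alphaPart G A₁ (M ∩ C₁)`:
    ((alphaPart G A₁ (M ∩ C₁)).Nonempty →
        IsProbe G a₂ a (M ∩ C₁) (alphaPart G A₁ (M ∩ C₁))) ∧
    (alphaPart G A₁ (M ∩ C₁) = ∅ → (M ∩ C₁).card = 1) ∧
    -- for `i = 2`, with `M₂ = C₁ \ M` and `α(M₂) = A₁ \ α(M₁)`:
    ((A₁ \ alphaPart G A₁ (M ∩ C₁)).Nonempty →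
        IsProbe G a₂ a (C₁ \ M) (A₁ \ alphaPart G A₁ (M ∩ C₁))) ∧
    (A₁ \ alphaPart G A₁ (M ∩ C₁) = ∅ → (C₁ \ M).card = 1) := by
  have hcases : ∀ t : V, t = a ∨ t = a₂ ∨ t ∈ C₁ ∨ t ∈ A₁ := fun t => by
    simpa using (hcover ▸ Finset.mem_univ t : t ∈ insert a (insert a₂ (C₁ ∪ A₁)))
  have hdisj : ∀ v ∈ C₁, v ∉ A₁ := fun v hv hv' => Finset.disjoint_left.1 hCA hv hv'
  have ha₂C₁ : ∀ v ∈ C₁, ¬ G.Adj a₂ v := fun v hv => ha₂par v (Finset.mem_union_left _ hv)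
  have ha₂A₁ : ∀ v ∈ A₁, ¬ G.Adj a₂ v := fun v hv => ha₂par v (Finset.mem_union_right _ hv)
  have hCM : ∀ v ∈ C₁, v ∉ M → ∀ m ∈ M, G.Adj v m := fun v hv hvM =>
    (hmod.2 v (by simp [hv]) hvM).resolve_right fun h => h a haM (haC₁ v hv).symm
  have hAM : ∀ v ∈ A₁, v ∉ M → ∀ m ∈ M, ¬ G.Adj v m := fun v hv hvM =>
    (hmod.2 v (by simp [hv]) hvM).resolve_left fun h => haA₁ v hv (h a haM).symm
  have hsub : ∀ v ∈ alphaPart G A₁ (M ∩ C₁), v ∈ A₁ := fun v hv => alphaPart_subset hv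
  have hRM : ∀ v ∈ alphaPart G A₁ (M ∩ C₁), v ∈ M := fun v hv =>
    mem_of_mem_alphaPart (T := M)
      (fun v hv m hm h => by_contra fun hvM =>
        hAM v (hsub v hv) hvM m (Finset.mem_inter.1 hm).1 h)
      (fun u hu v hv h => by_contra fun hvM => hAM v (hsub v hv) hvM u hu h.symm) hv
  have hadj : ∀ v ∈ A₁, ∀ m ∈ M, m ∈ C₁ → G.Adj v m → v ∈ alphaPart G A₁ (M ∩ C₁) :=
    fun v hv m hm hm' h => mem_alphaPart_of_adj hv (Finset.mem_inter.2 ⟨hm, hm'⟩) h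
  have hclosed : ∀ u ∈ alphaPart G A₁ (M ∩ C₁), ∀ v ∈ A₁, G.Adj u v →
      v ∈ alphaPart G A₁ (M ∩ C₁) := fun u hu v hv h => alphaPart_adj_closed hu hv h
  have hleast := fun T : Set V => mem_of_mem_alphaPart (G := G) (A := A₁) (X := M ∩ C₁) (T := T)
  generalize alphaPart G A₁ (M ∩ C₁) = R at *
  obtain ⟨m₁, hm₁⟩ := hM₁
  obtain ⟨m₂, hm₂⟩ := hM₂
  have hm₁' := Finset.mem_inter.1 hm₁
  have hm₂' := Finset.mem_sdiff.1 hm₂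
  refine ⟨fun hR => ?_, fun hR => ?_, fun hR => ?_, fun hR => ?_⟩
  · refine ⟨⟨m₁, hm₁⟩, hR, hne.symm, by simp [haC], fun h => haA (hsub _ h), by simp [ha₂C],
      fun h => ha₂A (hsub _ h), ?_, ?_, haa₂.symm, ?_, ?_, fun v hv => haA₁ v (hsub v hv), ?_, ?_⟩
    · exact Finset.disjoint_left.2 fun v hv hv' => hdisj v (Finset.mem_inter.1 hv).2 (hsub v hv')
    · intro h
      have := h ▸ Finset.mem_univ m₂
      simp only [Finset.mem_insert, Finset.mem_union, Finset.mem_inter] at this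
      grind
    · grind
    · grind
    · refine SimpleGraph.induce_connected_of_adj_closed (x := a) (by simp) fun T haT hT => ?_
      have hT1 : ∀ v ∈ M ∩ C₁, v ∈ T := fun v hv =>
        hT a haT v (by simp only [Finset.mem_coe]; grind) (haC₁ v (Finset.mem_inter.1 hv).2)
      have hT2 : ∀ v ∈ R, v ∈ T := fun v hv => hleast T
        (fun v hv m hm h => hT m (hT1 m hm) v (by simp only [Finset.mem_coe]; grind) h.symm)
        (fun u hu v hv h => hT u hu v (by simp only [Finset.mem_coe]; grind) h) hv
      have hT3 : a₂ ∈ T := hT a haT a₂ (by simp) haa₂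
      intro v hv
      simp only [Finset.mem_coe] at hv
      grind
    · intro t ht
      have hs : ∀ u v, G.Adj u v → G.Adj v u := fun _ _ h => h.symm
      rcases hcases t with rfl | rfl | htC | htA
      · simp at ht
      · simp at ht
      · refine Or.inr (Or.inr fun v hv => ?_)
        exact hCM t htC (by grind) v (by grind)
      · refine Or.inl fun v hv h => ?_
        grind
  · refine hprime.card_eq_one ⟨m₁, hm₁⟩ (fun t ht => ?_) (x := a) (by simp [haC])
    rcases hcases t with rfl | rfl | htC | htA
    · exact Or.inl fun m hm => haC₁ m (Finset.mem_inter.1 hm).2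
    · exact Or.inr fun m hm => ha₂C₁ m (Finset.mem_inter.1 hm).2
    · exact Or.inl fun m hm => hCM t htC (by grind) m (Finset.mem_inter.1 hm).1
    · exact Or.inr fun m hm h => by grind
  · have hs : ∀ u v, G.Adj u v → G.Adj v u := fun _ _ h => h.symm
    refine ⟨⟨m₂, hm₂⟩, hR, hne.symm, by simp [haC], by simp [haA], by simp [ha₂C],
      by simp [ha₂A], ?_, ?_, haa₂.symm, ?_, ?_, ?_, ?_, ?_⟩
    · exact Finset.disjoint_left.2 fun v hv hv' => by grind
    · intro h
      have := h ▸ Finset.mem_univ m₁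
      simp only [Finset.mem_insert, Finset.mem_union, Finset.mem_sdiff] at this
      grind
    · grind
    · grind
    · grind
    · refine SimpleGraph.induce_connected_of_adj_closed (x := a) (by simp) fun T haT hT => ?_
      have hT1 : ∀ v ∈ C₁ \ M, v ∈ T := fun v hv =>
        hT a haT v (by simp only [Finset.mem_coe]; grind) (haC₁ v (Finset.mem_sdiff.1 hv).1)
      have hT3 : a₂ ∈ T := hT a haT a₂ (by simp) haa₂
      have hT4 : ∀ u ∈ T, ∀ v ∈ A₁ \ R, G.Adj u v → v ∈ T := fun u hu v hv h =>
        hT u hu v (by simp only [Finset.mem_coe]; grind) h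
      have hT2 : ∀ v, v ∈ A₁ \ R → v ∈ T := by
        refine hconn.mem_of_adj_closed (T := {v | v ∈ A₁ \ R → v ∈ T}) (x := a)
          (fun _ => haT) fun u hu v huv hv => ?_
        simp only [Set.mem_ofPred_eq] at hu
        have := hcases u
        grind
      intro v hv
      simp only [Finset.mem_coe] at hv
      grind
    · intro t ht
      rcases hcases t with rfl | rfl | htC | htA
      · simp at ht
      · simp at ht
      · refine Or.inr (Or.inl ⟨fun v hv => ?_, fun v hv h => ?_⟩)
        · exact (hCM v (by grind) (by grind) t (by grind)).symm
        · grind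
      · refine Or.inr (Or.inl ⟨fun v hv => ?_, fun v hv h => ?_⟩)
        · exact (hCM v (by grind) (by grind) t (hRM t (by grind))).symm
        · grind
  · refine hprime.card_eq_one ⟨m₂, hm₂⟩ (fun t ht => ?_) (x := a) (by simp [haC])
    rcases hcases t with rfl | rfl | htC | htA
    · exact Or.inl fun m hm => haC₁ m (Finset.mem_sdiff.1 hm).1
    · exact Or.inr fun m hm => ha₂C₁ m (Finset.mem_sdiff.1 hm).1
    · exact Or.inl fun m hm => (hCM m (by grind) (by grind) t (by grind)).symm
    · exact Or.inl fun m hm =>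
        (hCM m (by grind) (by grind) t (hRM t (Finset.sdiff_eq_empty_iff_subset.1 hR htA))).symm
end
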